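/- Suppose additionally that f is bounded above, i.e. f^* := sup_x f(x) < +∞, and set Δ_* = f^* − f_*. There is an absolute constant C > 0 such that, under assumptions (A1)–(A4), for every T ≥ 1 the AdaGrad-Norm iterates satisfy the squared-gradient bound E[(1/T)∑_{t=1}^T ‖∇f(x_t)‖₂²] ≤ C·( A²/T + B·‖σ‖_p / T^{(p−1)/p} ), where A = √(λΔ_*/γ) + Δ_*/γ + γ‖L‖_∞ and B = Δ_*/γ + γ‖L‖_∞. -/

import Mathlib

open MeasureTheory Finset

/-- The AdaGrad-Norm accumulator `v_t = ∑_{s=1}^t ‖g_s‖₂²`. -/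
noncomputable def adaNormV {Ω : Type} {d : ℕ} (g : ℕ → Ω → EuclideanSpace ℝ (Fin d))
    (t : ℕ) (ω : Ω) : ℝ :=
  ∑ s ∈ Finset.Icc 1 t, ‖g s ω‖ ^ 2

/-- The natural filtration `F_t = σ(g_1, …, g_t)`. -/
noncomputable def natFilt {Ω : Type} [MeasurableSpace Ω] {d : ℕ}
    (g : ℕ → Ω → EuclideanSpace ℝ (Fin d)) (t : ℕ) : MeasurableSpace Ω :=
  ⨆ s ∈ Finset.Icc 1 t, MeasurableSpace.comap (g s) inferInstance

/-- Summation by parts with nondecreasing nonnegative weights and a sequence bounded above. -/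
lemma sum_mul_sub_succ_le (b F : ℕ → ℝ) (D : ℝ) (hb0 : 0 ≤ b 0) (hb : Monotone b)
    (hF : ∀ t, F t ≤ D) (T : ℕ) :
    ∑ t ∈ Icc 1 T, b t * (F t - F (t + 1)) ≤ b T * (D - F (T + 1)) := by
  induction T with
  | zero => simpa using mul_nonneg hb0 (sub_nonneg.2 (hF 1))
  | succ T ih =>
    rw [sum_Icc_succ_top (by omega)]
    nlinarith [mul_nonneg (sub_nonneg.2 (hb (Nat.le_succ T))) (sub_nonneg.2 (hF (T + 1)))]

/-- The self-normalized sum bound underlying AdaGrad-type analyses. -/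
lemma sum_div_add_sqrt_sum_le (a : ℕ → ℝ) (ha : ∀ t, 0 ≤ a t) {lam : ℝ} (hlam : 0 < lam)
    (T : ℕ) :
    ∑ t ∈ Icc 1 T, a t / (lam + √(∑ s ∈ Icc 1 t, a s)) ≤ 2 * √(∑ s ∈ Icc 1 T, a s) := by
  induction T with
  | zero => simp
  | succ T ih =>
    rw [sum_Icc_succ_top (by omega)]
    set s := √(∑ s ∈ Icc 1 T, a s) with hs
    set s' := √(∑ s ∈ Icc 1 (T + 1), a s) with hs'
    have hle : s ≤ s' := Real.sqrt_le_sqrt (by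
      rw [sum_Icc_succ_top (by omega)]; linarith [ha (T + 1)])
    have hs0 : 0 ≤ s := Real.sqrt_nonneg _
    have ha' : a (T + 1) = s' ^ 2 - s ^ 2 := by
      rw [hs, hs', Real.sq_sqrt (sum_nonneg fun i _ => ha i),
        Real.sq_sqrt (sum_nonneg fun i _ => ha i), sum_Icc_succ_top (by omega)]
      ring
    have : a (T + 1) / (lam + s') ≤ 2 * (s' - s) := by
      rw [div_le_iff₀ (by linarith), ha']
      nlinarith [mul_nonneg (sub_nonneg.2 hle) hlam.le]
    linarith

/-- Monotonicity of finite `ℓ^p` norms, comparing `ℓ²` with `ℓ^p` for `p ≤ 2`. -/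
lemma sqrt_sum_sq_le_sum_rpow_rpow {ι : Type*} (s : Finset ι) (a : ι → ℝ) {p : ℝ}
    (hp : 0 < p) (hp2 : p ≤ 2) :
    √(∑ i ∈ s, a i ^ 2) ≤ (∑ i ∈ s, |a i| ^ p) ^ (1 / p) := by
  have key : ∀ s : Finset ι, ∑ i ∈ s, a i ^ 2 ≤ (∑ i ∈ s, |a i| ^ p) ^ (2 / p) := by
    classical
    intro s
    induction s using Finset.induction_on with
    | empty => simp [Real.zero_rpow (show (2 / p) ≠ 0 by positivity)]
    | insert i s his ih =>
      rw [sum_insert his, sum_insert his]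
      refine le_trans ?_ (Real.add_rpow_le_rpow_add (by positivity)
        (sum_nonneg fun _ _ => by positivity) ((one_le_div hp).2 hp2))
      refine add_le_add (le_of_eq ?_) ih
      rw [← Real.rpow_mul (abs_nonneg _), mul_div_cancel₀ _ hp.ne']
      simp
  have h0 : 0 ≤ ∑ i ∈ s, |a i| ^ p := sum_nonneg fun _ _ => by positivity
  refine Real.sqrt_le_iff.2 ⟨by positivity, (key s).trans (le_of_eq ?_)⟩
  rw [← Real.rpow_natCast, ← Real.rpow_mul h0]
  congr 1
  push_cast
  ring

/-- Quadratic upper bound along a step, from coordinate-wise smoothness. -/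
lemma apply_sub_smul_le {d : ℕ} {f : EuclideanSpace ℝ (Fin d) → ℝ}
    {gradf : EuclideanSpace ℝ (Fin d) → EuclideanSpace ℝ (Fin d)} {L : Fin d → ℝ} {M : ℝ}
    (hLM : ∀ i, L i ≤ M)
    (hsm : ∀ u v : EuclideanSpace ℝ (Fin d),
      |f u - f v - ∑ i, gradf v i * (u i - v i)| ≤ 1 / 2 * ∑ i, L i * (u i - v i) ^ 2)
    (y h : EuclideanSpace ℝ (Fin d)) (c : ℝ) :
    f (y - c • h) ≤ f y - c * ∑ i, gradf y i * h i + M / 2 * c ^ 2 * ‖h‖ ^ 2 := by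
  have h1 := (abs_le.1 (hsm (y - c • h) y)).2
  have e1 : ∑ i, gradf y i * ((y - c • h) i - y i) = -(c * ∑ i, gradf y i * h i) := by
    rw [mul_sum, ← sum_neg_distrib]
    exact sum_congr rfl fun i _ => by simp; ring
  have e2 : ∑ i, L i * ((y - c • h) i - y i) ^ 2 ≤ M * c ^ 2 * ‖h‖ ^ 2 := by
    rw [EuclideanSpace.real_norm_sq_eq, mul_sum]
    refine sum_le_sum fun i _ => ?_
    have : L i * ((y - c • h) i - y i) ^ 2 = L i * (c ^ 2 * h i ^ 2) := by
      simp only [PiLp.sub_apply, PiLp.smul_apply, smul_eq_mul]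
      ring
    rw [this, mul_assoc]
    exact mul_le_mul_of_nonneg_right (hLM i) (by positivity)
  rw [e1] at h1
  linarith

/-- A bounded smooth function has bounded gradient. -/
lemma norm_sq_grad_le {d : ℕ} {f : EuclideanSpace ℝ (Fin d) → ℝ}
    {gradf : EuclideanSpace ℝ (Fin d) → EuclideanSpace ℝ (Fin d)} {L : Fin d → ℝ} {M m D : ℝ}
    (hM : 0 < M) (hLM : ∀ i, L i ≤ M)
    (hsm : ∀ u v : EuclideanSpace ℝ (Fin d),
      |f u - f v - ∑ i, gradf v i * (u i - v i)| ≤ 1 / 2 * ∑ i, L i * (u i - v i) ^ 2)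
    (hm : ∀ y, m ≤ f y) (hD : ∀ y, f y ≤ D) (y : EuclideanSpace ℝ (Fin d)) :
    ‖gradf y‖ ^ 2 ≤ 2 * M * (D - m) := by
  have h := apply_sub_smul_le hLM hsm y (gradf y) (1 / M)
  have e : ∑ i, gradf y i * gradf y i = ‖gradf y‖ ^ 2 := by
    rw [EuclideanSpace.real_norm_sq_eq]
    exact sum_congr rfl fun i _ => (sq _).symm
  have e2 : M / 2 * (1 / M) ^ 2 * ‖gradf y‖ ^ 2 = 1 / M * ‖gradf y‖ ^ 2 / 2 := by
    field_simp
  rw [e, e2] at h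
  have h3 : 1 / M * ‖gradf y‖ ^ 2 ≤ 2 * (D - m) := by
    linarith [hm (y - (1 / M) • gradf y), hD y]
  rw [one_div, inv_mul_le_iff₀ hM] at h3
  linarith

/-- The pathwise regret-type inequality for AdaGrad-Norm on a bounded objective. -/
lemma adagradNorm_sum_inner_le {Ω : Type} {d : ℕ} {f : EuclideanSpace ℝ (Fin d) → ℝ}
    {gradf : EuclideanSpace ℝ (Fin d) → EuclideanSpace ℝ (Fin d)} {L : Fin d → ℝ} {M m D : ℝ}
    {g x : ℕ → Ω → EuclideanSpace ℝ (Fin d)} {γ lam : ℝ} (hγ : 0 < γ) (hlam : 0 < lam)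
    (hM : 0 ≤ M) (hLM : ∀ i, L i ≤ M)
    (hsm : ∀ u v : EuclideanSpace ℝ (Fin d),
      |f u - f v - ∑ i, gradf v i * (u i - v i)| ≤ 1 / 2 * ∑ i, L i * (u i - v i) ^ 2)
    (hm : ∀ y, m ≤ f y) (hD : ∀ y, f y ≤ D)
    (hx : ∀ t, 1 ≤ t → ∀ ω,
      x (t + 1) ω = x t ω - (γ / (lam + Real.sqrt (adaNormV g t ω))) • g t ω)
    (T : ℕ) (ω : Ω) :
    ∑ t ∈ Icc 1 T, ∑ i, gradf (x t ω) i * g t ω i ≤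
      lam * (D - m) / γ + ((D - m) / γ + γ * M) * √(adaNormV g T ω) := by
  set b : ℕ → ℝ := fun t => lam + √(adaNormV g t ω) with hbdef
  have hbpos : ∀ t, 0 < b t := fun t => by positivity
  have hbmono : Monotone b := fun s t hst => by
    refine add_le_add_right (Real.sqrt_le_sqrt ?_) _
    exact sum_le_sum_of_subset_of_nonneg (Icc_subset_Icc_right hst) fun _ _ _ => by positivity
  have hstep : ∀ t ∈ Icc 1 T, γ * ∑ i, gradf (x t ω) i * g t ω i ≤
      b t * (f (x t ω) - f (x (t + 1) ω)) + γ ^ 2 * M / 2 * (‖g t ω‖ ^ 2 / b t) := by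
    intro t ht
    have h := apply_sub_smul_le hLM hsm (x t ω) (g t ω) (γ / b t)
    rw [← hx t (mem_Icc.1 ht).1 ω] at h
    have hb := hbpos t
    have h' := mul_le_mul_of_nonneg_left h hb.le
    have e : b t * (f (x t ω) - γ / b t * ∑ i, gradf (x t ω) i * g t ω i
        + M / 2 * (γ / b t) ^ 2 * ‖g t ω‖ ^ 2) = b t * f (x t ω)
        - γ * ∑ i, gradf (x t ω) i * g t ω i + γ ^ 2 * M / 2 * (‖g t ω‖ ^ 2 / b t) := by
      field_simp
    linarith
  have hsum := sum_le_sum hstep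
  rw [← mul_sum, sum_add_distrib, ← mul_sum] at hsum
  have h1 := sum_mul_sub_succ_le b (fun t => f (x t ω)) D (hbpos 0).le hbmono
    (fun t => hD _) T
  have h2 := sum_div_add_sqrt_sum_le (fun t => ‖g t ω‖ ^ 2) (fun t => by positivity) hlam T
  have h3 : b T * (D - f (x (T + 1) ω)) ≤ b T * (D - m) :=
    mul_le_mul_of_nonneg_left (by linarith [hm (x (T + 1) ω)]) (hbpos T).le
  have h4 := mul_le_mul_of_nonneg_left h2 (show 0 ≤ γ ^ 2 * M / 2 by positivity)
  have h5 : γ * ∑ t ∈ Icc 1 T, ∑ i, gradf (x t ω) i * g t ω i ≤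
      γ * (lam * (D - m) / γ + ((D - m) / γ + γ * M) * √(adaNormV g T ω)) := by
    have e : γ * (lam * (D - m) / γ + ((D - m) / γ + γ * M) * √(adaNormV g T ω)) =
        b T * (D - m) + γ ^ 2 * M / 2 * (2 * √(adaNormV g T ω)) := by
      simp only [hbdef]; field_simp; ring
    rw [e]
    exact hsum.trans (add_le_add (h1.trans h3) h4)
  exact le_of_mul_le_mul_left h5 hγ

/-- Splitting the AdaGrad-Norm accumulator into gradient and noise parts. -/
lemma mul_sqrt_adaNormV_le {Ω : Type} {d : ℕ} (g G : ℕ → Ω → EuclideanSpace ℝ (Fin d))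
    {B p : ℝ} (hB : 0 ≤ B) (hp : 0 < p) (hp2 : p ≤ 2) (T : ℕ) (ω : Ω) :
    B * √(adaNormV g T ω) ≤ B ^ 2 + (∑ t ∈ Icc 1 T, ‖G t ω‖ ^ 2) / 2 +
      √2 * B * (∑ t ∈ Icc 1 T, ∑ i, |g t ω i - G t ω i| ^ p) ^ (1 / p) := by
  set S := ∑ t ∈ Icc 1 T, ‖G t ω‖ ^ 2 with hS
  set N := ∑ t ∈ Icc 1 T, ∑ i, (g t ω i - G t ω i) ^ 2 with hN
  have hS0 : 0 ≤ S := sum_nonneg fun _ _ => by positivity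
  have hN0 : 0 ≤ N := sum_nonneg fun _ _ => sum_nonneg fun _ _ => by positivity
  have hv : adaNormV g T ω ≤ 2 * S + 2 * N := by
    rw [adaNormV, hS, hN, mul_sum, mul_sum, ← sum_add_distrib]
    refine sum_le_sum fun t _ => ?_
    rw [EuclideanSpace.real_norm_sq_eq, EuclideanSpace.real_norm_sq_eq, mul_sum, mul_sum,
      ← sum_add_distrib]
    exact sum_le_sum fun i _ => by nlinarith [sq_nonneg (g t ω i - 2 * G t ω i)]
  have hN' : √N ≤ (∑ t ∈ Icc 1 T, ∑ i, |g t ω i - G t ω i| ^ p) ^ (1 / p) := by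
    have := sqrt_sum_sq_le_sum_rpow_rpow (Icc 1 T ×ˢ (univ : Finset (Fin d)))
      (fun q => g q.1 ω q.2 - G q.1 ω q.2) hp hp2
    rwa [sum_product, sum_product] at this
  have h1 : √(adaNormV g T ω) ≤ √(2 * S) + √2 * √N := by
    rw [← Real.sqrt_mul (by norm_num)]
    refine Real.sqrt_le_iff.2 ⟨by positivity, ?_⟩
    nlinarith [Real.sq_sqrt (show 0 ≤ 2 * S by positivity),
      Real.sq_sqrt (show 0 ≤ 2 * N by positivity),
      mul_nonneg (Real.sqrt_nonneg (2 * S)) (Real.sqrt_nonneg (2 * N))]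
  have h2 : B * √(2 * S) ≤ B ^ 2 + S / 2 := by
    nlinarith [Real.sq_sqrt (show 0 ≤ 2 * S by positivity), sq_nonneg (2 * B - √(2 * S))]
  have h3 := mul_le_mul_of_nonneg_left hN' (show 0 ≤ √2 * B by positivity)
  nlinarith [mul_le_mul_of_nonneg_left h1 hB]

/-- A gradient field is measurable. -/
lemma measurable_of_hasGradientAt {d : ℕ} {f : EuclideanSpace ℝ (Fin d) → ℝ}
    {gradf : EuclideanSpace ℝ (Fin d) → EuclideanSpace ℝ (Fin d)}
    (h : ∀ y, HasGradientAt f (gradf y) y) : Measurable gradf := by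
  have : gradf = fun y => (InnerProductSpace.toDual ℝ (EuclideanSpace ℝ (Fin d))).symm
      (fderiv ℝ f y) := by
    funext y
    rw [(h y).hasFDerivAt.fderiv, LinearIsometryEquiv.symm_apply_apply]
  rw [this]
  exact (LinearIsometryEquiv.continuous _).measurable.comp (measurable_fderiv ℝ f)

lemma natFilt_le {Ω : Type} [mΩ : MeasurableSpace Ω] {d : ℕ}
    {g : ℕ → Ω → EuclideanSpace ℝ (Fin d)} (hg : ∀ t, Measurable (g t)) (t : ℕ) :
    natFilt g t ≤ mΩ :=
  iSup₂_le fun s _ => (hg s).comap_le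

lemma natFilt_mono {Ω : Type} [MeasurableSpace Ω] {d : ℕ}
    (g : ℕ → Ω → EuclideanSpace ℝ (Fin d)) : Monotone (natFilt g) := fun _ _ hst =>
  iSup₂_le fun r hr => le_iSup₂_of_le r (Icc_subset_Icc_right hst hr) le_rfl

lemma measurable_natFilt {Ω : Type} [MeasurableSpace Ω] {d : ℕ}
    (g : ℕ → Ω → EuclideanSpace ℝ (Fin d)) {s t : ℕ} (hs : s ∈ Icc 1 t) :
    Measurable[natFilt g t] (g s) :=
  (comap_measurable (g s)).mono (le_iSup₂_of_le s hs le_rfl) le_rfl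

/-- The AdaGrad-Norm iterates are predictable. -/
lemma adagradNorm_measurable_iterate {Ω : Type} [MeasurableSpace Ω] {d : ℕ}
    {g x : ℕ → Ω → EuclideanSpace ℝ (Fin d)} {x₁ : EuclideanSpace ℝ (Fin d)} {γ lam : ℝ}
    (hx1 : ∀ ω, x 1 ω = x₁)
    (hx : ∀ t, 1 ≤ t → ∀ ω,
      x (t + 1) ω = x t ω - (γ / (lam + Real.sqrt (adaNormV g t ω))) • g t ω)
    {t : ℕ} (ht : 1 ≤ t) : Measurable[natFilt g (t - 1)] (x t) := by
  induction t, ht using Nat.le_induction with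
  | base =>
    rw [show x 1 = fun _ => x₁ from funext hx1]
    exact @measurable_const _ _ _ (natFilt g (1 - 1)) _
  | succ t ht ih =>
    have hle : natFilt g (t - 1) ≤ natFilt g t := natFilt_mono g (Nat.sub_le t 1)
    rw [show x (t + 1) = fun ω => x t ω - (γ / (lam + √(adaNormV g t ω))) • g t ω from
      funext (hx t ht), Nat.add_sub_cancel]
    let _ : MeasurableSpace Ω := natFilt g t
    have hv : Measurable fun ω => adaNormV g t ω :=
      Finset.measurable_fun_sum _ fun s hs => (measurable_natFilt g hs).norm.pow_const 2
    have hgt : Measurable (g t) := measurable_natFilt g (mem_Icc.2 ⟨ht, le_rfl⟩)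
    have hxt : Measurable (x t) := ih.mono hle le_rfl
    exact hxt.sub ((measurable_const.div (measurable_const.add hv.sqrt)).smul hgt)

/-- Jensen's inequality for the concave power `z ↦ z ^ q`, `q ∈ [0, 1]`, together with
integrability of the power. -/
lemma integrable_rpow_and_integral_rpow_le {Ω : Type*} [MeasurableSpace Ω] {μ : Measure Ω}
    [IsProbabilityMeasure μ] {Z : Ω → ℝ} (hZ : Integrable Z μ) (hZ0 : ∀ ω, 0 ≤ Z ω) {q : ℝ}
    (hq0 : 0 ≤ q) (hq1 : q ≤ 1) :
    Integrable (fun ω => Z ω ^ q) μ ∧ ∫ ω, Z ω ^ q ∂μ ≤ (∫ ω, Z ω ∂μ) ^ q := by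
  have hint : Integrable (fun ω => Z ω ^ q) μ := by
    refine Integrable.mono' ((integrable_const (1 : ℝ)).add hZ)
      (hZ.aemeasurable.pow_const q).aestronglyMeasurable (Filter.Eventually.of_forall fun ω => ?_)
    rw [Real.norm_of_nonneg (Real.rpow_nonneg (hZ0 ω) q)]
    rcases le_total (Z ω) 1 with h | h
    · exact (Real.rpow_le_one (hZ0 ω) h hq0).trans (le_add_of_nonneg_right (hZ0 ω))
    · exact (Real.rpow_le_self_of_one_le h hq1).trans (le_add_of_nonneg_left zero_le_one)
  exact ⟨hint, (Real.concaveOn_rpow hq0 hq1).le_map_integral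
    (Real.continuous_rpow_const hq0).continuousOn isClosed_Ici
    (Filter.Eventually.of_forall hZ0) hZ hint⟩

/-- If `X` is the conditional expectation of `Y` given `m`, is bounded and `m`-measurable,
then `𝔼[X Y] = 𝔼[X²]`. -/
lemma integrable_mul_and_integral_mul_eq_of_condExp {Ω : Type*} {m mΩ : MeasurableSpace Ω}
    {μ : Measure Ω} [IsProbabilityMeasure μ] (hm : m ≤ mΩ) {X Y : Ω → ℝ}
    (hX : Measurable[m] X) (hY : Integrable Y μ) {c : ℝ} (hc : ∀ ω, |X ω| ≤ c)
    (h : μ[Y | m] =ᵐ[μ] X) :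
    Integrable (fun ω => X ω * Y ω) μ ∧ ∫ ω, X ω * Y ω ∂μ = ∫ ω, X ω ^ 2 ∂μ := by
  refine ⟨hY.bdd_mul (hX.mono hm le_rfl).aestronglyMeasurable
    (Filter.Eventually.of_forall hc), ?_⟩
  have h1 := condExp_stronglyMeasurable_mul_of_bound hm hX.stronglyMeasurable hY c
    (Filter.Eventually.of_forall hc)
  calc ∫ ω, X ω * Y ω ∂μ = ∫ ω, (μ[X * Y | m]) ω ∂μ := (integral_condExp hm).symm
    _ = ∫ ω, X ω ^ 2 ∂μ := by
      refine integral_congr_ae ?_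
      filter_upwards [h1, h] with ω h1 h2
      rw [h1, Pi.mul_apply, h2, sq]

/-- squared-gradient convergence of AdaGrad-Norm for bounded
objectives.  There is an absolute constant `C > 0` such that, under (A1)–(A4)
and `sup f < ∞`, for every `T ≥ 1`,
`E[(1/T)∑_{t=1}^T ‖∇f(x_t)‖₂²] ≤ C(A²/T + B‖σ‖_p/T^{(p−1)/p})`,
where `Δ_* = sup f − inf f`, `A = √(λΔ_*/γ) + Δ_*/γ + γ‖L‖_∞` and
`B = Δ_*/γ + γ‖L‖_∞`. -/
theorem adagradNorm_bounded_objective_squared_rate :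
    ∃ C : ℝ, 0 < C ∧
    ∀ (d : ℕ) (Ω : Type) [MeasurableSpace Ω] (μ : Measure Ω) [IsProbabilityMeasure μ]
      (f : EuclideanSpace ℝ (Fin d) → ℝ)
      (gradf : EuclideanSpace ℝ (Fin d) → EuclideanSpace ℝ (Fin d))
      (g x : ℕ → Ω → EuclideanSpace ℝ (Fin d)) (x₁ : EuclideanSpace ℝ (Fin d))
      (γ lam p : ℝ) (L σ : Fin d → ℝ),
      0 < γ → 0 < lam →
      (∀ y, HasGradientAt f (gradf y) y) →
      -- (A1) lower boundedness
      BddBelow (Set.range f) →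
      -- additional assumption for Statements 2/3: boundedness above (omitted in 5)
      BddAbove (Set.range f) →
      -- (A2) coordinate-wise smoothness
      (∀ i, 0 < L i) →
      (∀ u v : EuclideanSpace ℝ (Fin d),
        |f u - f v - ∑ i, gradf v i * (u i - v i)| ≤ 1 / 2 * ∑ i, L i * (u i - v i) ^ 2) →
      (∀ t, Measurable (g t)) →
      (∀ t, Integrable (g t) μ) →
      -- AdaGrad-Norm dynamics
      (∀ ω, x 1 ω = x₁) →
      (∀ t, 1 ≤ t → ∀ ω,
        x (t + 1) ω = x t ω - (γ / (lam + Real.sqrt (adaNormV g t ω))) • g t ω) →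
      -- (A3) unbiasedness
      (∀ t, 1 ≤ t → ∀ i : Fin d,
        μ[(fun ω => g t ω i) | natFilt g (t - 1)] =ᵐ[μ] fun ω => gradf (x t ω) i) →
      -- (A4) heavy-tailed noise
      1 < p → p ≤ 2 → (∀ i, 0 ≤ σ i) →
      (∀ t, 1 ≤ t → ∀ i : Fin d,
        Integrable (fun ω => |g t ω i - gradf (x t ω) i| ^ p) μ ∧
        ∀ᵐ ω ∂μ,
          (μ[(fun ω' => |g t ω' i - gradf (x t ω') i| ^ p) | natFilt g (t - 1)]) ω ≤ σ i ^ p) →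
      ∀ T : ℕ, 1 ≤ T →
      (∫ ω, (1 / (T : ℝ)) * ∑ t ∈ Finset.Icc 1 T, ‖gradf (x t ω)‖ ^ 2 ∂μ) ≤
        C * ((Real.sqrt (lam * ((⨆ y, f y) - ⨅ y, f y) / γ) +
                ((⨆ y, f y) - ⨅ y, f y) / γ + γ * (⨆ i, L i)) ^ 2 / (T : ℝ) +
              (((⨆ y, f y) - ⨅ y, f y) / γ + γ * (⨆ i, L i)) *
                (∑ i, σ i ^ p) ^ (1 / p) / (T : ℝ) ^ ((p - 1) / p)) := by
  refine ⟨3, by norm_num, ?_⟩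
  intro d Ω _ μ _ f gradf g x x₁ γ lam p L σ hγ hlam hgrad hbelow habove hL hsm hgm hgi hx1 hx
    hunb hp1 hp2 hσ hnoise T hT
  set m := ⨅ y, f y with hmdef
  set D := ⨆ y, f y with hDdef
  set M := ⨆ i, L i with hMdef
  have hm : ∀ y, m ≤ f y := ciInf_le hbelow
  have hD : ∀ y, f y ≤ D := le_ciSup habove
  have hLM : ∀ i, L i ≤ M := le_ciSup (Set.finite_range L).bddAbove
  have hM : 0 ≤ M := Real.iSup_nonneg fun i => (hL i).le
  have hmD : 0 ≤ D - m := sub_nonneg.2 ((hm 0).trans (hD 0))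
  have hp0 : 0 < p := by linarith
  have hT0 : (0 : ℝ) < T := by exact_mod_cast hT
  set B := (D - m) / γ + γ * M with hBdef
  have hB : 0 ≤ B := by positivity
  have hgradm := measurable_of_hasGradientAt hgrad
  have hcoord : ∀ i : Fin d, Measurable fun y : EuclideanSpace ℝ (Fin d) => y i :=
    fun i => (EuclideanSpace.proj (𝕜 := ℝ) i).continuous.measurable
  have hGm : ∀ t, 1 ≤ t → ∀ i, Measurable[natFilt g (t - 1)] fun ω => gradf (x t ω) i :=
    fun t ht i => ((hcoord i).comp hgradm).comp (adagradNorm_measurable_iterate hx1 hx ht)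
  have hGbdd : ∀ y i, |gradf y i| ≤ √(2 * (M + 1) * (D - m)) := fun y i => by
    refine Real.abs_le_sqrt (le_trans ?_ (norm_sq_grad_le (by positivity)
      (fun i => (hLM i).trans (by linarith)) hsm hm hD y))
    rw [EuclideanSpace.real_norm_sq_eq]
    exact single_le_sum (f := fun i => gradf y i ^ 2) (fun _ _ => sq_nonneg _) (mem_univ i)
  have hgint : ∀ t (i : Fin d), Integrable (fun ω => g t ω i) μ := fun t i =>
    (EuclideanSpace.proj (𝕜 := ℝ) i).integrable_comp (hgi t)
  have hmul : ∀ t ∈ Icc 1 T, ∀ i, Integrable (fun ω => gradf (x t ω) i * g t ω i) μ ∧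
      ∫ ω, gradf (x t ω) i * g t ω i ∂μ = ∫ ω, gradf (x t ω) i ^ 2 ∂μ := fun t ht i =>
    integrable_mul_and_integral_mul_eq_of_condExp (natFilt_le hgm (t - 1))
      (hGm t (mem_Icc.1 ht).1 i) (hgint t i) (fun ω => hGbdd _ i) (hunb t (mem_Icc.1 ht).1 i)
  have hsq : ∀ t ∈ Icc 1 T, ∀ i, Integrable (fun ω => gradf (x t ω) i ^ 2) μ := fun t ht i => by
    refine Integrable.of_bound
      (((hGm t (mem_Icc.1 ht).1 i).mono (natFilt_le hgm _) le_rfl).pow_const 2).aestronglyMeasurable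
      (√(2 * (M + 1) * (D - m)) ^ 2) (Filter.Eventually.of_forall fun ω => ?_)
    rw [norm_pow]
    exact pow_le_pow_left₀ (norm_nonneg _) (hGbdd _ i) 2
  set S : Ω → ℝ := fun ω => ∑ t ∈ Icc 1 T, ‖gradf (x t ω)‖ ^ 2 with hSdef
  set Z : Ω → ℝ := fun ω => ∑ t ∈ Icc 1 T, ∑ i, |g t ω i - gradf (x t ω) i| ^ p with hZdef
  have hSeq : S = fun ω => ∑ t ∈ Icc 1 T, ∑ i, gradf (x t ω) i ^ 2 := by
    simp only [hSdef, EuclideanSpace.real_norm_sq_eq]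
  have hSint : Integrable S μ := by
    rw [hSeq]
    exact integrable_finsetSum _ fun t ht => integrable_finsetSum _ fun i _ => hsq t ht i
  have hinner_int : Integrable (fun ω => ∑ t ∈ Icc 1 T, ∑ i, gradf (x t ω) i * g t ω i) μ :=
    integrable_finsetSum _ fun t ht => integrable_finsetSum _ fun i _ => (hmul t ht i).1
  have hinner : ∫ ω, ∑ t ∈ Icc 1 T, ∑ i, gradf (x t ω) i * g t ω i ∂μ = ∫ ω, S ω ∂μ := by
    rw [hSeq, integral_finsetSum _ fun t ht => integrable_finsetSum _ fun i _ => (hmul t ht i).1,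
      integral_finsetSum _ fun t ht => integrable_finsetSum _ fun i _ => hsq t ht i]
    refine sum_congr rfl fun t ht => ?_
    rw [integral_finsetSum _ fun i _ => (hmul t ht i).1,
      integral_finsetSum _ fun i _ => hsq t ht i]
    exact sum_congr rfl fun i _ => (hmul t ht i).2
  have hZint : Integrable Z μ := integrable_finsetSum _ fun t ht =>
    integrable_finsetSum _ fun i _ => (hnoise t (mem_Icc.1 ht).1 i).1
  have hZ0 : ∀ ω, 0 ≤ Z ω := fun ω => sum_nonneg fun _ _ => sum_nonneg fun _ _ => by positivity
  have hZle : ∫ ω, Z ω ∂μ ≤ T * ∑ i, σ i ^ p := by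
    rw [integral_finsetSum _ fun t ht =>
      integrable_finsetSum _ fun i _ => (hnoise t (mem_Icc.1 ht).1 i).1]
    have hterm : ∀ t ∈ Icc 1 T,
        ∫ ω, ∑ i, |g t ω i - gradf (x t ω) i| ^ p ∂μ ≤ ∑ i, σ i ^ p := fun t ht => by
      rw [integral_finsetSum _ fun i _ => (hnoise t (mem_Icc.1 ht).1 i).1]
      refine sum_le_sum fun i _ => ?_
      rw [← integral_condExp (natFilt_le hgm (t - 1))]
      refine (integral_mono_ae integrable_condExp (integrable_const (σ i ^ p))
        (hnoise t (mem_Icc.1 ht).1 i).2).trans_eq ?_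
      simp
    refine (sum_le_sum hterm).trans_eq ?_
    simp
  obtain ⟨hZpint, hZp⟩ := integrable_rpow_and_integral_rpow_le hZint hZ0
    (q := 1 / p) (by positivity) ((div_le_one hp0).2 hp1.le)
  have hσ0 : 0 ≤ ∑ i, σ i ^ p := sum_nonneg fun i _ => Real.rpow_nonneg (hσ i) p
  set N := (∑ i, σ i ^ p) ^ (1 / p) with hNdef
  have hN0 : 0 ≤ N := Real.rpow_nonneg hσ0 _
  have hZN : ∫ ω, Z ω ^ (1 / p) ∂μ ≤ (T : ℝ) ^ (1 / p) * N := by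
    rw [hNdef, ← Real.mul_rpow hT0.le hσ0]
    exact hZp.trans (Real.rpow_le_rpow (integral_nonneg hZ0) hZle (by positivity))
  have hpath : ∀ ω, ∑ t ∈ Icc 1 T, ∑ i, gradf (x t ω) i * g t ω i ≤
      (lam * (D - m) / γ + B ^ 2) + S ω / 2 + √2 * B * Z ω ^ (1 / p) := fun ω => by
    have h1 := adagradNorm_sum_inner_le hγ hlam hM hLM hsm hm hD hx T ω
    have h2 := mul_sqrt_adaNormV_le g (fun t ω => gradf (x t ω)) hB hp0 hp2 T ω
    linarith
  have hmain : ∫ ω, S ω ∂μ ≤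
      (lam * (D - m) / γ + B ^ 2) + (∫ ω, S ω ∂μ) / 2 + √2 * B * ((T : ℝ) ^ (1 / p) * N) := by
    have hconst : Integrable (fun _ : Ω => lam * (D - m) / γ + B ^ 2) μ := integrable_const _
    have hadd := hconst.add (hSint.div_const 2)
    have h := integral_mono hinner_int (hadd.add (hZpint.const_mul (√2 * B))) hpath
    rw [hinner, integral_add' hadd (hZpint.const_mul _), integral_add' hconst (hSint.div_const 2),
      integral_const, integral_div, integral_const_mul, probReal_univ, one_smul] at h
    exact h.trans (add_le_add_right
      (mul_le_mul_of_nonneg_left hZN (by positivity)) _)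
  have hsqrt2 : √2 ≤ 3 / 2 := Real.sqrt_le_iff.2 ⟨by norm_num, by norm_num⟩
  have hA : lam * (D - m) / γ + B ^ 2 ≤ (√(lam * (D - m) / γ) + (D - m) / γ + γ * M) ^ 2 := by
    have h0 : 0 ≤ lam * (D - m) / γ := by positivity
    rw [add_assoc, ← hBdef]
    nlinarith [Real.sq_sqrt h0, mul_nonneg (Real.sqrt_nonneg (lam * (D - m) / γ)) hB]
  set Q := (√(lam * (D - m) / γ) + (D - m) / γ + γ * M) ^ 2 with hQdef
  have hQ : 0 ≤ Q := sq_nonneg _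
  have hfinal : ∫ ω, S ω ∂μ ≤ 3 * (Q + B * ((T : ℝ) ^ (1 / p) * N)) := by
    have h := mul_le_mul_of_nonneg_right hsqrt2
      (show 0 ≤ B * ((T : ℝ) ^ (1 / p) * N) by positivity)
    linarith
  have hpow : (T : ℝ) ^ (1 / p) = T / (T : ℝ) ^ ((p - 1) / p) := by
    rw [eq_div_iff (by positivity), ← Real.rpow_add hT0,
      show 1 / p + (p - 1) / p = 1 by field_simp; ring, Real.rpow_one]
  rw [integral_const_mul]
  calc 1 / (T : ℝ) * ∫ ω, S ω ∂μ ≤ 1 / (T : ℝ) * (3 * (Q + B * ((T : ℝ) ^ (1 / p) * N))) :=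
        mul_le_mul_of_nonneg_left hfinal (by positivity)
    _ = 3 * (Q / T + B * N / (T : ℝ) ^ ((p - 1) / p)) := by
        rw [hpow]
        field_simp
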